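/- arXiv:2206.12739 — 5 statements merged into one kernel-verified Lean document; each statement's English description precedes it below -/
import Mathlib

section
/- (Lemma: data separability and max-margin lower bound.) For any δ ∈ (0,1) and problem parameters satisfying, for a sufficiently large constant C > 0, d ≥ C n ‖μ_c‖₂², ‖μ_c‖₂ ≥ C √(log(n/δ)) and n ≥ C, the following holds with probability at least 1 − δ over n i.i.d. GMM training samples: the vectors z_1, …, z_n are linearly separable (there exists w with ⟨w, z_i⟩ > 0 for all i ∈ [n]), and moreover there is a constant c₂ > 0 such that the maximum margin satisfies max_{‖w‖₂ = 1} min_{i∈[n]} ⟨w, z_i⟩ ≥ c₂ √(d/n). -/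
open MeasureTheory ProbabilityTheory Real Filter Finset
open scoped Classical

noncomputable section

/-- Euclidean dot product on `Fin d → ℝ`. -/
def dotp {d : ℕ} (u v : Fin d → ℝ) : ℝ := ∑ k, u k * v k

/-- Euclidean norm on `Fin d → ℝ`. -/
def nrm {d : ℕ} (u : Fin d → ℝ) : ℝ := Real.sqrt (dotp u u)

/-- Standard Gaussian measure `N(0, I_d)` on `Fin d → ℝ`. -/
def stdGaussian (d : ℕ) : Measure (Fin d → ℝ) :=
  Measure.pi fun _ => gaussianReal 0 1

/-- Law of the noise vectors `q_1, …, q_n`, i.i.d. `N(0, I_d)`. -/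
def noiseMeasure (n d : ℕ) : Measure (Fin n → Fin d → ℝ) :=
  Measure.pi fun _ => stdGaussian d

/-- The standard Gaussian tail function `Q(t) = P(N(0,1) > t)`. -/
def Qfun (t : ℝ) : ℝ := (gaussianReal 0 1 {x | t < x}).toReal

/-- Group mean `ν_b = [μ_c ; b μ_s]` (for disjointly supported `μ_c, μ_s`). -/
def nuVec {d : ℕ} (μc μs : Fin d → ℝ) (b : ℝ) : Fin d → ℝ := fun k => μc k + b * μs k

/-- `R_+ = ‖μ_c‖² + ‖μ_s‖²`. -/
def Rp {d : ℕ} (μc μs : Fin d → ℝ) : ℝ := dotp μc μc + dotp μs μs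

/-- `R_− = ‖μ_c‖² − ‖μ_s‖²`. -/
def Rm {d : ℕ} (μc μs : Fin d → ℝ) : ℝ := dotp μc μc - dotp μs μs

/-- Error of the linear classifier `w` on group `b`:
`P{⟨w, ν_b + q⟩ < 0}` for `q ~ N(0, I_d)`, i.e. `P{y⟨w,x⟩<0 | y·a=b}` under the GMM. -/
def groupErr {d : ℕ} (μc μs : Fin d → ℝ) (b : ℝ) (w : Fin d → ℝ) : ℝ :=
  (stdGaussian d {q | dotp w (fun k => nuVec μc μs b k + q k) < 0}).toReal

/-- Worst-group error of direction `w`. -/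
def Rwst {d : ℕ} (μc μs : Fin d → ℝ) (w : Fin d → ℝ) : ℝ :=
  max (groupErr μc μs 1 w) (groupErr μc μs (-1) w)

/-- Training vectors `z_i = y_i x_i = ν_{b_i} + q_i`. -/
def zvec {n d : ℕ} (μc μs : Fin d → ℝ) (bs : Fin n → ℝ) (q : Fin n → Fin d → ℝ) :
    Fin n → Fin d → ℝ := fun i k => nuVec μc μs (bs i) k + q i k

/-- Negative per-sample loss derivative of the exponential VS-loss:
`ℓ′_i(w) = Δ_{b_i} ω_{b_i} exp(−Δ_{b_i} ⟨z_i, w⟩ + ι_{b_i})`. -/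
def ellp {n d : ℕ} (z : Fin n → Fin d → ℝ) (bs : Fin n → ℝ)
    (Δ ω ι : ℝ → ℝ) (w : Fin d → ℝ) (i : Fin n) : ℝ :=
  Δ (bs i) * ω (bs i) * Real.exp (-(Δ (bs i)) * dotp (z i) w + ι (bs i))

/-- Gradient descent on the exponential VS-loss:
`w^{t+1} = w^t + η Σ_i ℓ′_{i,t} z_i`. -/
def gd {n d : ℕ} (η : ℝ) (z : Fin n → Fin d → ℝ) (bs : Fin n → ℝ)
    (Δ ω ι : ℝ → ℝ) (w0 : Fin d → ℝ) : ℕ → Fin d → ℝ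
  | 0 => w0
  | t + 1 => fun k =>
      gd η z bs Δ ω ι w0 t k +
        η * ∑ i, ellp z bs Δ ω ι (gd η z bs Δ ω ι w0 t) i * z i k

/-- Group sizes `n_b = |{i : b_i = b}|`. -/
def ngroup {n : ℕ} (bs : Fin n → ℝ) (b : ℝ) : ℕ :=
  (Finset.univ.filter fun i => bs i = b).card

/-- Problem-regime assumption with constant `C`:
(A) `n ≥ C log(1/δ)`; (B) `‖μ_c‖² ≥ C log(n/δ)`; (C) `d ≥ C R_+ n`;
(D) `d ≥ C n² log(n/δ)`. -/
def Regime {d : ℕ} (C : ℝ) (n : ℕ) (μc μs : Fin d → ℝ) (δ : ℝ) : Prop :=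
  (n : ℝ) ≥ C * Real.log (1 / δ) ∧
  dotp μc μc ≥ C * Real.log (n / δ) ∧
  (d : ℝ) ≥ C * Rp μc μs * n ∧
  (d : ℝ) ≥ C * (n : ℝ) ^ 2 * Real.log ((n : ℝ) / δ)

/-- Parts (A)–(C) of the problem-regime assumption. -/
def RegimeABC {d : ℕ} (C : ℝ) (n : ℕ) (μc μs : Fin d → ℝ) (δ : ℝ) : Prop :=
  (n : ℝ) ≥ C * Real.log (1 / δ) ∧
  dotp μc μc ≥ C * Real.log (n / δ) ∧
  (d : ℝ) ≥ C * Rp μc μs * n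

/-- The good event of Lemma 3 (with constant `c₁`): norm bounds, mean-correlation
bounds, and pairwise inner-product bounds for the training vectors. -/
def GoodEvent {n d : ℕ} (c₁ : ℝ) (μc μs : Fin d → ℝ) (bs : Fin n → ℝ) (δ : ℝ)
    (z : Fin n → Fin d → ℝ) : Prop :=
  (∀ i, dotp (z i) (z i) ≤ c₁ * d) ∧
  (∀ i, (d : ℝ) / c₁ ≤ dotp (z i) (z i)) ∧
  (∀ i, |dotp (z i) (nuVec μc μs (bs i)) - Rp μc μs| ≤ Rp μc μs / 2) ∧
  (∀ i, |dotp (z i) (nuVec μc μs (-(bs i))) - Rm μc μs| ≤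
      c₁ * Real.sqrt (Rp μc μs) * Real.sqrt (Real.log (n / δ))) ∧
  (∀ i j, i ≠ j →
      |dotp (z i) (z j) - (if bs i = bs j then Rp μc μs else Rm μc μs)| ≤
        c₁ * Real.sqrt d * Real.sqrt (Real.log (n / δ)))

/-- VS-loss hyperparameter tuning of Theorem 1:
`(1/2)(n_±/n) ≤ Δ_± ≤ 2(n_±/n)` and `(ω₊ e^{ι₊})/(ω₋ e^{ι₋}) = Δ₋²/Δ₊²`. -/
def VSTuned {n : ℕ} (bs : Fin n → ℝ) (Δ ω ι : ℝ → ℝ) : Prop :=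
  (1 / 2 * ((ngroup bs 1 : ℝ) / n) ≤ Δ 1 ∧ Δ 1 ≤ 2 * ((ngroup bs 1 : ℝ) / n)) ∧
  (1 / 2 * ((ngroup bs (-1) : ℝ) / n) ≤ Δ (-1) ∧
      Δ (-1) ≤ 2 * ((ngroup bs (-1) : ℝ) / n)) ∧
  0 < ω 1 ∧ 0 < ω (-1) ∧
  ω 1 * Real.exp (ι 1) / (ω (-1) * Real.exp (ι (-1))) = Δ (-1) ^ 2 / Δ 1 ^ 2

/-- Cumulative gradient sum `L′_{t₁:t} = Σ_{τ=t₁}^{t} Σ_{i∈[n]} ℓ′_{i,τ}`. -/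
def Lcum {n d : ℕ} (η : ℝ) (z : Fin n → Fin d → ℝ) (bs : Fin n → ℝ)
    (Δ ω ι : ℝ → ℝ) (w0 : Fin d → ℝ) (t₁ t : ℕ) : ℝ :=
  ∑ τ ∈ Finset.Icc t₁ t, ∑ i, ellp z bs Δ ω ι (gd η z bs Δ ω ι w0 τ) i

/-- Per-group cumulative gradient sum `L′_{t₁:t,b} = Σ_{τ=t₁}^{t} Σ_{i: b_i=b} ℓ′_{i,τ}`. -/
def LcumG {n d : ℕ} (η : ℝ) (z : Fin n → Fin d → ℝ) (bs : Fin n → ℝ)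
    (Δ ω ι : ℝ → ℝ) (w0 : Fin d → ℝ) (b : ℝ) (t₁ t : ℕ) : ℝ :=
  ∑ τ ∈ Finset.Icc t₁ t, ∑ i ∈ Finset.univ.filter (fun i => bs i = b),
    ellp z bs Δ ω ι (gd η z bs Δ ω ι w0 τ) i


/-- Tonelli for products of nonnegative functions of separate coordinates. -/
lemma lint_pi_prod {E : Type*} [MeasurableSpace E] (μ : Measure E) [IsProbabilityMeasure μ]
    (n : ℕ) (f : Fin n → E → ENNReal) (hf : ∀ i, Measurable (f i)) :
    ∫⁻ x, ∏ i, f i (x i) ∂(Measure.pi fun _ : Fin n => μ) = ∏ i, ∫⁻ x, f i x ∂μ := by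
  induction n with
  | zero => simp
  | succ n ih =>
    have h := (measurePreserving_piFinSuccAbove (fun _ : Fin (n+1) => μ) 0).symm
    rw [← h.lintegral_comp_emb (MeasurableEquiv.measurableEmbedding _)]
    simp only [MeasurableEquiv.piFinSuccAbove_symm_apply, Fin.insertNthEquiv,
      Fin.prod_univ_succ, Fin.insertNth_zero, Equiv.coe_fn_mk, Fin.cons_succ, Fin.cons_zero]
    rw [← ih (fun i => f i.succ) (fun i => hf i.succ)]
    exact lintegral_prod_mul (μ := μ) (ν := Measure.pi fun _ : Fin n => μ) (hf 0).aemeasurable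
      (Finset.measurable_prod _ fun (i : Fin n) _ => (hf i.succ).comp (measurable_pi_apply i)).aemeasurable

instance stdGaussian_prob (d : ℕ) : IsProbabilityMeasure (_root_.stdGaussian d) := by
  unfold _root_.stdGaussian; infer_instance

instance noise_prob (n d : ℕ) : IsProbabilityMeasure (noiseMeasure n d) := by
  unfold noiseMeasure; infer_instance

lemma gauss_lin (a : ℝ) :
    ∫⁻ x, ENNReal.ofReal (Real.exp (a * x)) ∂(gaussianReal 0 1)
      = ENNReal.ofReal (Real.exp (a ^ 2 / 2)) := by
  rw [← ofReal_integral_eq_lintegral_ofReal (integrable_exp_mul_gaussianReal a)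
    (ae_of_all _ fun x => (Real.exp_pos _).le)]
  have h := mgf_gaussianReal (p := gaussianReal 0 1) (X := id) (μ := 0) (v := 1) (by simp) a
  simp only [mgf, id] at h
  rw [h]; simp

lemma log_bd (s : ℝ) (h1 : -(1/4) ≤ s) (h2 : s ≤ 1/4) :
    Real.exp (-(2 * s + 4 * s ^ 2)) ≤ 1 - 2 * s := by
  rw [Real.exp_neg]
  apply inv_le_of_inv_le₀ (by linarith)
  rw [inv_le_iff_one_le_mul₀ (by linarith)]
  rcases le_total 0 s with hs | hs
  · have h := Real.quadratic_le_exp_of_nonneg (x := 2 * s + 4 * s ^ 2) (by positivity)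
    refine le_trans ?_ (mul_le_mul_of_nonneg_right h (by linarith))
    have h3 : 0 ≤ s ^ 2 := by positivity
    have h4 : 0 ≤ s ^ 3 := by positivity
    have h5 : 0 ≤ s ^ 4 := by positivity
    nlinarith [mul_nonneg h3 (sub_nonneg.2 h2), mul_nonneg h4 (sub_nonneg.2 h2),
      mul_nonneg h5 (sub_nonneg.2 h2)]
  · have h := Real.add_one_le_exp (2 * s + 4 * s ^ 2)
    refine le_trans ?_ (mul_le_mul_of_nonneg_right h (by linarith))
    nlinarith [mul_nonneg (neg_nonneg.2 hs) (sq_nonneg s)]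

lemma gauss_sq (s : ℝ) (h1 : -(1/4) ≤ s) (h2 : s ≤ 1/4) :
    ∫⁻ x, ENNReal.ofReal (Real.exp (s * x ^ 2)) ∂(gaussianReal 0 1)
      ≤ ENNReal.ofReal (Real.exp (s + 2 * s ^ 2)) := by
  have hb : 0 < 1 / 2 - s := by linarith
  rw [gaussianReal_of_var_ne_zero _ one_ne_zero,
    lintegral_withDensity_eq_lintegral_mul _ (measurable_gaussianPDF _ _) (by fun_prop)]
  have e : ∀ x : ℝ, (gaussianPDF 0 1 * fun x => ENNReal.ofReal (Real.exp (s * x ^ 2))) x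
      = ENNReal.ofReal ((Real.sqrt (2 * π))⁻¹ * Real.exp (-(1/2 - s) * x ^ 2)) := by
    intro x
    rw [Pi.mul_apply, gaussianPDF, ← ENNReal.ofReal_mul (gaussianPDFReal_nonneg _ _ _),
      gaussianPDFReal, mul_assoc, ← Real.exp_add]
    congr 2
    · simp
    · congr 1; simp; ring
  rw [lintegral_congr e, ← ofReal_integral_eq_lintegral_ofReal
    ((integrable_exp_neg_mul_sq hb).const_mul _) (ae_of_all _ fun x => by positivity)]
  apply ENNReal.ofReal_le_ofReal
  rw [integral_const_mul, integral_gaussian, ← Real.sqrt_inv, ← Real.sqrt_mul (by positivity)]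
  apply Real.sqrt_le_iff.2 ⟨(Real.exp_pos _).le, ?_⟩
  have : (2 * π)⁻¹ * (π / (1 / 2 - s)) = (1 - 2 * s)⁻¹ := by
    have := Real.pi_pos
    have : 1 - 2 * s ≠ 0 := by linarith
    field_simp
  rw [this, ← Real.exp_nat_mul]
  have h := log_bd s h1 h2
  have h3 := inv_anti₀ (Real.exp_pos _) h
  rw [← Real.exp_neg] at h3
  refine h3.trans (le_of_eq ?_)
  congr 1; push_cast; ring

lemma std_lin {d : ℕ} (v : Fin d → ℝ) :
    ∫⁻ q, ENNReal.ofReal (Real.exp (dotp v q)) ∂(_root_.stdGaussian d)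
      = ENNReal.ofReal (Real.exp (dotp v v / 2)) := by
  have e : ∀ q : Fin d → ℝ, ENNReal.ofReal (Real.exp (dotp v q))
      = ∏ k, ENNReal.ofReal (Real.exp (v k * q k)) := by
    intro q
    rw [← ENNReal.ofReal_prod_of_nonneg fun _ _ => (Real.exp_pos _).le, ← Real.exp_sum]; rfl
  unfold _root_.stdGaussian
  rw [lintegral_congr e,
    lint_pi_prod _ d (fun k x => ENNReal.ofReal (Real.exp (v k * x))) (fun k => by fun_prop)]
  simp only [gauss_lin]
  rw [← ENNReal.ofReal_prod_of_nonneg fun _ _ => (Real.exp_pos _).le, ← Real.exp_sum,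
    ← Finset.sum_div]
  simp [dotp, sq]

lemma std_sq (d : ℕ) (s : ℝ) (h1 : -(1/4) ≤ s) (h2 : s ≤ 1/4) :
    ∫⁻ q, ENNReal.ofReal (Real.exp (s * dotp q q)) ∂(_root_.stdGaussian d)
      ≤ ENNReal.ofReal (Real.exp (d * (s + 2 * s ^ 2))) := by
  have e : ∀ q : Fin d → ℝ, ENNReal.ofReal (Real.exp (s * dotp q q))
      = ∏ k, ENNReal.ofReal (Real.exp (s * q k ^ 2)) := by
    intro q
    rw [← ENNReal.ofReal_prod_of_nonneg fun _ _ => (Real.exp_pos _).le, ← Real.exp_sum]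
    simp [dotp, sq, Finset.mul_sum]
  unfold _root_.stdGaussian
  rw [lintegral_congr e,
    lint_pi_prod _ d (fun k x => ENNReal.ofReal (Real.exp (s * x ^ 2))) (fun k => by fun_prop)]
  refine (Finset.prod_le_prod' fun _ _ => gauss_sq s h1 h2).trans (le_of_eq ?_)
  rw [← ENNReal.ofReal_prod_of_nonneg fun _ _ => (Real.exp_pos _).le, ← Real.exp_sum]
  rw [Finset.sum_const, Finset.card_univ, Fintype.card_fin, nsmul_eq_mul]

lemma measurable_dotp {α : Type*} [MeasurableSpace α] {d : ℕ} {f g : α → Fin d → ℝ}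
    (hf : Measurable f) (hg : Measurable g) : Measurable fun x => dotp (f x) (g x) := by
  unfold dotp; fun_prop

/-- Cross term mgf. -/
lemma cross_mgf (m d : ℕ) (j : Fin (m + 1)) (l : ℝ) (hl : m * l ^ 2 / 2 ≤ 1 / 4) :
    ∫⁻ q, ENNReal.ofReal (Real.exp (l * ∑ i : Fin m, dotp (q j) (q (j.succAbove i))))
        ∂(noiseMeasure (m + 1) d)
      ≤ ENNReal.ofReal (Real.exp (d * (m * l ^ 2 / 2 + 2 * (m * l ^ 2 / 2) ^ 2))) := by
  have h := (measurePreserving_piFinSuccAbove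
    (fun _ : Fin (m+1) => _root_.stdGaussian d) j).symm
  unfold noiseMeasure
  rw [← h.lintegral_comp_emb (MeasurableEquiv.measurableEmbedding _)]
  simp only [MeasurableEquiv.piFinSuccAbove_symm_apply, Fin.insertNthEquiv, Equiv.coe_fn_mk,
    Fin.insertNth_apply_same, Fin.insertNth_apply_succAbove]
  rw [lintegral_prod]
  swap
  · apply Measurable.aemeasurable
    apply ENNReal.measurable_ofReal.comp
    apply Real.measurable_exp.comp
    apply Measurable.const_mul
    apply Finset.measurable_sum
    intro i _
    exact measurable_dotp measurable_fst ((measurable_pi_apply i).comp measurable_snd)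
  have e : ∀ x : Fin d → ℝ,
      ∫⁻ y, ENNReal.ofReal (Real.exp (l * ∑ i : Fin m, dotp x (y i)))
        ∂(Measure.pi fun _ : Fin m => _root_.stdGaussian d)
      = ENNReal.ofReal (Real.exp (m * l ^ 2 / 2 * dotp x x)) := by
    intro x
    have e2 : ∀ y : Fin m → Fin d → ℝ,
        ENNReal.ofReal (Real.exp (l * ∑ i : Fin m, dotp x (y i)))
        = ∏ i, ENNReal.ofReal (Real.exp (dotp (l • x) (y i))) := by
      intro y
      rw [← ENNReal.ofReal_prod_of_nonneg fun _ _ => (Real.exp_pos _).le, ← Real.exp_sum]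
      simp [dotp, Finset.mul_sum, mul_assoc]
    rw [lintegral_congr e2, lint_pi_prod _ m
      (fun _ y => ENNReal.ofReal (Real.exp (dotp (l • x) y)))
      (fun _ => ENNReal.measurable_ofReal.comp (Real.measurable_exp.comp
        (measurable_dotp measurable_const measurable_id)))]
    simp only [std_lin]
    rw [← ENNReal.ofReal_prod_of_nonneg fun _ _ => (Real.exp_pos _).le, ← Real.exp_sum]
    have : dotp (l • x) (l • x) = l ^ 2 * dotp x x := by
      simp only [dotp, Finset.mul_sum, Pi.smul_apply, smul_eq_mul]
      exact Finset.sum_congr rfl fun _ _ => by ring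
    rw [this]; simp; ring_nf
  have hp : (0:ℝ) ≤ m * l ^ 2 / 2 := by positivity
  refine le_trans (le_of_eq ?_) (std_sq d _ (by linarith) hl)
  exact lintegral_congr e

lemma chernoff {α : Type*} [MeasurableSpace α] (μ : Measure α) (f : α → ℝ) (hf : Measurable f)
    (A t B : ℝ) (h : ∫⁻ x, ENNReal.ofReal (Real.exp (f x)) ∂μ ≤ ENNReal.ofReal (Real.exp A))
    (hB : A - t ≤ B) :
    μ {x | t ≤ f x} ≤ ENNReal.ofReal (Real.exp B) := by
  have h1 := (mul_meas_ge_le_lintegral (μ := μ)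
    (ENNReal.measurable_ofReal.comp (Real.measurable_exp.comp hf))
    (ENNReal.ofReal (Real.exp t))).trans h
  have e : {x | t ≤ f x} = {x | ENNReal.ofReal (Real.exp t) ≤
      (ENNReal.ofReal ∘ Real.exp ∘ f) x} := by
    ext x; simp [ENNReal.ofReal_le_ofReal_iff (Real.exp_pos _).le]
  rw [← e] at h1
  calc μ {x | t ≤ f x}
      = ENNReal.ofReal (Real.exp (-t)) * (ENNReal.ofReal (Real.exp t) * μ {x | t ≤ f x}) := by
        rw [← mul_assoc, ← ENNReal.ofReal_mul (Real.exp_pos _).le, ← Real.exp_add]; simp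
    _ ≤ ENNReal.ofReal (Real.exp (-t)) * ENNReal.ofReal (Real.exp A) := by gcongr
    _ = ENNReal.ofReal (Real.exp (A - t)) := by
        rw [← ENNReal.ofReal_mul (Real.exp_pos _).le, ← Real.exp_add]; congr 2; ring
    _ ≤ _ := ENNReal.ofReal_le_ofReal (Real.exp_le_exp.2 hB)

lemma dotp_eq {d : ℕ} (u v : Fin d → ℝ) : dotp u v = u ⬝ᵥ v := rfl

lemma determ {n d : ℕ} (hn : 0 < n) (μc μs : Fin d → ℝ) (bs : Fin n → ℝ)
    (q : Fin n → Fin d → ℝ) (L : ℝ) (hL : 0 ≤ L) (hd0 : (0:ℝ) < d)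
    (hdis : ∀ k, μc k = 0 ∨ μs k = 0)
    (hM : 256 * L ≤ dotp μc μc) (hdM : 16 * n * dotp μc μc ≤ d)
    (hs : ∀ j, |dotp μs (q j)| ≤ 2 * √L * √(dotp μs μs))
    (hc : ∀ j, |dotp μc (q j)| ≤ 2 * √L * √(dotp μc μc))
    (hX1 : ∀ j, (d:ℝ) / 2 - d / 8 ≤ ∑ i, dotp (q j) (q i))
    (hX2 : ∀ j, ∑ i, dotp (q j) (q i) ≤ 2 * (d:ℝ) + d / 8) :
    (∃ w : Fin d → ℝ, ∀ i, 0 < dotp w (zvec μc μs bs q i)) ∧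
      ∃ w : Fin d → ℝ, nrm w = 1 ∧
        ∀ i, 1 / 8 * Real.sqrt ((d : ℝ) / n) ≤ dotp w (zvec μc μs bs q i) := by
  have hn' : (0:ℝ) < n := by exact_mod_cast hn
  have hM0 : 0 ≤ dotp μc μc := by linarith
  have hT0 : 0 ≤ dotp μs μs := Finset.sum_nonneg fun _ _ => mul_self_nonneg _
  have hcs : dotp μc μs = 0 := Finset.sum_eq_zero fun k _ => by
    rcases hdis k with h | h <;> simp [h]
  set g : Fin d → ℝ := ∑ i, q i with hg
  set T := dotp μs μs with hT
  set a := dotp μs g / T with ha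
  have hsum : ∀ v : Fin d → ℝ, dotp v g = ∑ i, dotp v (q i) := by
    intro v; simp only [hg, dotp_eq, dotProduct_sum]
  have hsg : |dotp μs g| ≤ n * (2 * √L * √T) := by
    rw [hsum]
    refine (Finset.abs_sum_le_sum_abs _ _).trans ((Finset.sum_le_sum fun i _ => hs i).trans ?_)
    simp
  have hcg : |dotp μc g| ≤ n * (2 * √L * √(dotp μc μc)) := by
    rw [hsum]
    refine (Finset.abs_sum_le_sum_abs _ _).trans ((Finset.sum_le_sum fun i _ => hc i).trans ?_)
    simp
  have haT : a * T = dotp μs g := by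
    rcases hT0.eq_or_lt with h | h
    · have : dotp μs g = 0 := by
        apply abs_eq_zero.1
        rw [← h] at hsg
        simp only [Real.sqrt_zero, mul_zero] at hsg
        exact le_antisymm hsg (abs_nonneg _)
      rw [this, ← h]; simp
    · rw [ha]; field_simp
  set w : Fin d → ℝ := g - a • μs with hw
  have hwd : ∀ y, dotp w y = dotp g y - a * dotp μs y := by
    intro y; simp only [hw, dotp_eq, sub_dotProduct, smul_dotProduct, smul_eq_mul]
  have hcomm : ∀ u v : Fin d → ℝ, dotp u v = dotp v u := fun u v => by
    simp only [dotp_eq, dotProduct_comm]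
  have hz : ∀ i, dotp w (zvec μc μs bs q i) =
      dotp w μc + bs i * dotp w μs + dotp w (q i) := by
    intro i
    have : zvec μc μs bs q i = μc + bs i • μs + q i := by
      ext k; simp [zvec, nuVec]
    rw [this]; simp only [dotp_eq, dotProduct_add, dotProduct_smul, smul_eq_mul]
  have hws : dotp w μs = 0 := by
    rw [hwd, hcomm g, ← hT, haT, sub_self]
  have hwc : dotp w μc = dotp μc g := by
    rw [hwd, hcomm g, hcomm μs, hcs]; ring
  have hcg' : |dotp μc g| ≤ d / 128 := by
    have h1 : √L ≤ √(dotp μc μc) / 16 := by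
      rw [le_div_iff₀ (by norm_num)]
      apply Real.le_sqrt_of_sq_le
      rw [mul_pow, Real.sq_sqrt hL]; linarith
    have h2 : √L * √(dotp μc μc) ≤ dotp μc μc / 16 := by
      calc _ ≤ √(dotp μc μc) / 16 * √(dotp μc μc) := by gcongr
        _ = _ := by rw [div_mul_eq_mul_div, Real.mul_self_sqrt hM0]
    have h3 := mul_le_mul_of_nonneg_left h2 hn'.le
    linarith
  have hnL : n * (4 * L) ≤ d / 1024 := by
    have h3 := mul_le_mul_of_nonneg_left hM hn'.le
    linarith
  have haq : ∀ j, |a * dotp μs (q j)| ≤ n * (4 * L) := by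
    intro j
    rcases hT0.eq_or_lt with h | h
    · rw [ha, ← h]; simp; positivity
    · rw [ha, abs_mul, abs_div, abs_of_pos h, div_mul_eq_mul_div, div_le_iff₀ h]
      calc _ ≤ n * (2 * √L * √T) * (2 * √L * √T) := by
            gcongr
            exact hs j
        _ = n * (4 * (√L * √L)) * (√T * √T) := by ring
        _ = _ := by rw [Real.mul_self_sqrt hL, Real.mul_self_sqrt hT0]
  have hmain : ∀ i, (d:ℝ) / 4 ≤ dotp w (zvec μc μs bs q i) := by
    intro i
    rw [hz, hws, hwc, hwd, hcomm g (q i), hsum (q i)]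
    have h1 := (abs_le.1 hcg').1
    have h2 := (abs_le.1 (haq i)).2
    have h3 := hX1 i
    linarith
  have hww : dotp w w ≤ 4 * (n * d) := by
    have h1 : dotp w w = dotp g g - a ^ 2 * T := by
      rw [hwd, hcomm g w, hwd, hcomm μs w, hws, ← haT]; ring
    have h2 : dotp g g ≤ n * (2 * (d:ℝ) + d / 8) := by
      rw [hsum]
      calc ∑ i, dotp g (q i) ≤ ∑ i : Fin n, (2 * (d:ℝ) + d / 8) := by
            apply Finset.sum_le_sum; intro i _
            rw [hcomm, hsum]; exact hX2 i
        _ = _ := by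
          rw [Finset.sum_const, Finset.card_univ, Fintype.card_fin, nsmul_eq_mul]
    have h3 : 0 ≤ a ^ 2 * T := by positivity
    nlinarith [mul_pos hn' hd0]
  have hwpos : 0 < dotp w w := by
    have h0 : 0 ≤ dotp w w := Finset.sum_nonneg fun _ _ => mul_self_nonneg _
    rcases h0.eq_or_lt with h | h
    · exfalso
      have : w = 0 := dotProduct_self_eq_zero.1 h.symm
      have h1 := hmain ⟨0, hn⟩
      rw [this] at h1
      simp only [dotp_eq, zero_dotProduct] at h1
      linarith
    · exact h
  refine ⟨⟨w, fun i => by linarith [hmain i]⟩, (√(dotp w w))⁻¹ • w, ?_, ?_⟩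
  · unfold nrm
    simp only [dotp_eq, smul_dotProduct, dotProduct_smul, smul_eq_mul]
    rw [← dotp_eq, ← mul_assoc, ← mul_inv, Real.mul_self_sqrt hwpos.le,
      inv_mul_cancel₀ hwpos.ne', Real.sqrt_one]
  · intro i
    have e : dotp ((√(dotp w w))⁻¹ • w) (zvec μc μs bs q i)
        = (√(dotp w w))⁻¹ * dotp w (zvec μc μs bs q i) := by
      simp only [dotp_eq, smul_dotProduct, smul_eq_mul]
    have hsp : 0 < √(dotp w w) := Real.sqrt_pos.2 hwpos
    rw [e, inv_mul_eq_div, le_div_iff₀ hsp]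
    refine le_trans ?_ (hmain i)
    calc 1 / 8 * √((d:ℝ) / n) * √(dotp w w)
        ≤ 1 / 8 * √((d:ℝ) / n) * √(4 * (n * d)) := by gcongr
      _ = 1 / 8 * √((d:ℝ) / n * (4 * (n * d))) := by
          rw [Real.sqrt_mul (by positivity : (0:ℝ) ≤ d / n)]; ring
      _ = 1 / 8 * √((2 * d) ^ 2) := by congr 2; field_simp; norm_num
      _ = d / 4 := by rw [Real.sqrt_sq (by positivity)]; ring

lemma noise_eval {n d : ℕ} (j : Fin n) (s : Set (Fin d → ℝ)) (hs : MeasurableSet s) :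
    noiseMeasure n d {q | q j ∈ s} = _root_.stdGaussian d s :=
  (measurePreserving_eval (fun _ : Fin n => _root_.stdGaussian d) j).measure_preimage
    hs.nullMeasurableSet

lemma bad_lin {n d : ℕ} (j : Fin n) (v : Fin d → ℝ) (L : ℝ) (hL : 0 ≤ L) :
    noiseMeasure n d {q | 2 * √L * √(dotp v v) < dotp v (q j)}
      ≤ ENNReal.ofReal (Real.exp (-(2 * L))) := by
  have h0 : 0 ≤ dotp v v := Finset.sum_nonneg fun _ _ => mul_self_nonneg _
  rcases h0.eq_or_lt with h | h
  · have : v = 0 := dotProduct_self_eq_zero.1 h.symm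
    subst this
    simp [dotp_eq]
  · have hsp : 0 < √(dotp v v) := Real.sqrt_pos.2 h
    set θ := 2 * √L / √(dotp v v) with hθ
    have hm : Measurable fun q : Fin d → ℝ => dotp (θ • v) q :=
      measurable_dotp measurable_const measurable_id
    have hvv : dotp (θ • v) (θ • v) / 2 = 2 * L := by
      have : dotp (θ • v) (θ • v) = θ ^ 2 * dotp v v := by
        simp only [dotp_eq, smul_dotProduct, dotProduct_smul, smul_eq_mul]; ring
      rw [this, hθ, div_pow, mul_pow, Real.sq_sqrt hL, Real.sq_sqrt h0]; field_simp
    have hb := chernoff (_root_.stdGaussian d) _ hm (2 * L) (4 * L) (-(2 * L))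
      (by rw [std_lin, hvv]) (by linarith)
    rw [← noise_eval j _ (measurableSet_le measurable_const hm)] at hb
    refine (measure_mono ?_).trans hb
    intro q hq
    simp only [Set.mem_ofPred_eq] at hq ⊢
    have e : dotp (θ • v) (q j) = θ * dotp v (q j) := by
      simp only [dotp_eq, smul_dotProduct, smul_eq_mul]
    rw [e]
    calc 4 * L = θ * (2 * √L * √(dotp v v)) := by
          rw [hθ]; field_simp; rw [Real.sq_sqrt hL]; norm_num
      _ ≤ _ := by
          apply mul_le_mul_of_nonneg_left hq.le; positivity

lemma bad_sq {n d : ℕ} (j : Fin n) (L s t : ℝ) (h1 : -(1/4) ≤ s) (h2 : s ≤ 1/4)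
    (h : d * (s + 2 * s ^ 2) - t ≤ -(2 * L)) :
    noiseMeasure n d {q | t ≤ s * dotp (q j) (q j)} ≤ ENNReal.ofReal (Real.exp (-(2 * L))) := by
  have hm : Measurable fun q : Fin d → ℝ => s * dotp q q :=
    (measurable_dotp measurable_id measurable_id).const_mul _
  have hb := chernoff (_root_.stdGaussian d) _ hm _ t _ (std_sq d s h1 h2) h
  rw [← noise_eval j _ (measurableSet_le measurable_const hm)] at hb
  exact hb

lemma bad_cross {m d : ℕ} (j : Fin (m + 1)) (L l : ℝ) (hl : l ^ 2 = (1 / (16 * (m + 1))) ^ 2)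
    (hd : 16 * 16 * 2 * (m + 1 : ℝ) * L ≤ d) :
    noiseMeasure (m + 1) d
      {q | (1 / (16 * (m + 1 : ℝ))) * (d / 8) ≤
        l * ∑ i : Fin m, dotp (q j) (q (j.succAbove i))}
      ≤ ENNReal.ofReal (Real.exp (-(2 * L))) := by
  have hm : Measurable fun q : Fin (m + 1) → Fin d → ℝ =>
      l * ∑ i : Fin m, dotp (q j) (q (j.succAbove i)) := by
    apply Measurable.const_mul
    apply Finset.measurable_sum
    intro i _
    exact measurable_dotp (measurable_pi_apply _) (measurable_pi_apply _)
  have hmp : (0:ℝ) < m + 1 := by positivity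
  have hs : m * l ^ 2 / 2 ≤ 1 / (512 * (m + 1)) := by
    have e : m * l ^ 2 / 2 = m / (m + 1) * (1 / (512 * (m + 1))) := by
      rw [hl]; field_simp; ring
    rw [e]
    apply mul_le_of_le_one_left (by positivity)
    rw [div_le_one hmp]; linarith
  have hs2 : (1:ℝ) / (512 * (m + 1)) ≤ 1 / 512 := by
    apply one_div_le_one_div_of_le (by norm_num); linarith [Nat.cast_nonneg (α := ℝ) m]
  have hs0 : 0 ≤ m * l ^ 2 / 2 := by positivity
  refine chernoff _ _ hm _ _ _ (cross_mgf m d j l (by linarith)) ?_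
  have h1 : m * l ^ 2 / 2 + 2 * (m * l ^ 2 / 2) ^ 2 ≤ 1 / (256 * (m + 1)) := by
    have e : (1:ℝ) / (256 * (m + 1)) = 2 * (1 / (512 * (m + 1))) := by field_simp; norm_num
    rw [e]; nlinarith
  have h2 := mul_le_mul_of_nonneg_left h1 (Nat.cast_nonneg (α := ℝ) d)
  have h3 : (2:ℝ) * L ≤ d / (256 * (m + 1)) := by
    rw [le_div_iff₀ (by positivity)]; linarith
  have e1 : (d:ℝ) * (1 / (256 * (m + 1))) = d / (256 * (m + 1)) := by ring
  have e2 : (1 / (16 * (m + 1 : ℝ))) * (d / 8) = 2 * (d / (256 * (m + 1))) := by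
    field_simp; ring
  rw [e1] at h2; rw [e2]; linarith

/-- **Lemma (data separability and max-margin lower bound).** There are constants
`C₀, c₂ > 0` such that for any `δ ∈ (0,1)` and problem parameters with
`d ≥ C₀ n ‖μ_c‖²`, `‖μ_c‖ ≥ C₀ √(log(n/δ))` and `n ≥ C₀`, with probability at least
`1 − δ` over the training noise the vectors `z_1, …, z_n` are linearly separable and
the maximum margin is at least `c₂ √(d/n)`. -/
theorem data_separability_max_margin :
    ∃ C₀ : ℝ, 0 < C₀ ∧ ∃ c₂ : ℝ, 0 < c₂ ∧
      ∀ (n d : ℕ) (μc μs : Fin d → ℝ) (δ : ℝ),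
        0 < δ → δ < 1 →
        (∀ k, μc k = 0 ∨ μs k = 0) →
        (d : ℝ) ≥ C₀ * n * dotp μc μc →
        Real.sqrt (dotp μc μc) ≥ C₀ * Real.sqrt (Real.log ((n : ℝ) / δ)) →
        (n : ℝ) ≥ C₀ →
        ∀ bs : Fin n → ℝ, (∀ i, bs i = 1 ∨ bs i = -1) →
          ENNReal.ofReal (1 - δ) ≤
            noiseMeasure n d
              {q | (∃ w : Fin d → ℝ, ∀ i, 0 < dotp w (zvec μc μs bs q i)) ∧
                ∃ w : Fin d → ℝ, nrm w = 1 ∧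
                  ∀ i, c₂ * Real.sqrt ((d : ℝ) / n) ≤ dotp w (zvec μc μs bs q i)} := by
  refine ⟨16, by norm_num, 1 / 8, by norm_num, ?_⟩
  intro n d μc μs δ hδ0 hδ1 hdis hd hμ hn bs _
  obtain ⟨m, rfl⟩ : ∃ m, n = m + 1 := by
    cases n with
    | zero => norm_num at hn
    | succ m => exact ⟨m, rfl⟩
  set N : ℝ := ((m + 1 : ℕ) : ℝ) with hN
  have hNm : N = m + 1 := by rw [hN]; push_cast; ring
  have hN0 : 0 < N := by linarith
  set L := Real.log (N / δ) with hLdef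
  have hND : 1 < N / δ := by rw [lt_div_iff₀ hδ0]; linarith
  have hL : 0 < L := Real.log_pos hND
  have hM : 256 * L ≤ dotp μc μc := by
    have h0 : 0 ≤ dotp μc μc := Finset.sum_nonneg fun _ _ => mul_self_nonneg _
    have h1 : (16 * √L) ^ 2 ≤ √(dotp μc μc) ^ 2 := by gcongr
    rw [mul_pow, Real.sq_sqrt hL.le, Real.sq_sqrt h0] at h1
    linarith
  have hdL : 4096 * (N * L) ≤ d := by
    have := mul_le_mul_of_nonneg_left hM hN0.le
    linarith
  have hdL1 : 4096 * L ≤ d := by nlinarith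
  have hd0 : (0:ℝ) < d := by linarith
  set A := {q : Fin (m + 1) → Fin d → ℝ |
    (∃ w : Fin d → ℝ, ∀ i, 0 < dotp w (zvec μc μs bs q i)) ∧
      ∃ w : Fin d → ℝ, nrm w = 1 ∧
        ∀ i, 1 / 8 * Real.sqrt ((d : ℝ) / N) ≤ dotp w (zvec μc μs bs q i)} with hA
  set p := ENNReal.ofReal (Real.exp (-(2 * L))) with hp
  set l : ℝ := 1 / (16 * (m + 1)) with hl
  have hl0 : 0 < l := by positivity
  let B : Fin (m + 1) → Set (Fin (m + 1) → Fin d → ℝ) := fun j =>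
    {q | 2 * √L * √(dotp μs μs) < dotp μs (q j)} ∪
    ({q | 2 * √L * √(dotp (-μs) (-μs)) < dotp (-μs) (q j)} ∪
    ({q | 2 * √L * √(dotp μc μc) < dotp μc (q j)} ∪
    ({q | 2 * √L * √(dotp (-μc) (-μc)) < dotp (-μc) (q j)} ∪
    ({q | -(1/8) * ((d:ℝ) / 2) ≤ -(1/8) * dotp (q j) (q j)} ∪
    ({q | 1/8 * (2 * (d:ℝ)) ≤ 1/8 * dotp (q j) (q j)} ∪
    ({q | l * ((d:ℝ) / 8) ≤ l * ∑ i : Fin m, dotp (q j) (q (j.succAbove i))} ∪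
    {q | l * ((d:ℝ) / 8) ≤ -l * ∑ i : Fin m, dotp (q j) (q (j.succAbove i))}))))))
  have hB : ∀ j, noiseMeasure (m + 1) d (B j) ≤ 8 * p := by
    intro j
    have e : 8 * p = p + (p + (p + (p + (p + (p + (p + p)))))) := by ring
    rw [e]
    have hcr : 16 * 16 * 2 * (m + 1 : ℝ) * L ≤ d := by rw [← hNm]; nlinarith
    refine (measure_union_le _ _).trans (add_le_add (bad_lin j _ L hL.le) ?_)
    refine (measure_union_le _ _).trans (add_le_add (bad_lin j _ L hL.le) ?_)
    refine (measure_union_le _ _).trans (add_le_add (bad_lin j _ L hL.le) ?_)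
    refine (measure_union_le _ _).trans (add_le_add (bad_lin j _ L hL.le) ?_)
    refine (measure_union_le _ _).trans (add_le_add
      (bad_sq j L _ _ (by norm_num) (by norm_num) (by linarith)) ?_)
    refine (measure_union_le _ _).trans (add_le_add
      (bad_sq j L _ _ (by norm_num) (by norm_num) (by linarith)) ?_)
    exact (measure_union_le _ _).trans (add_le_add
      (bad_cross j L l rfl hcr) (bad_cross j L (-l) (by rw [neg_sq]) hcr))
  have hsub : Aᶜ ⊆ ⋃ j, B j := by
    intro q hq
    by_contra hcon
    apply hq
    simp only [B, Set.mem_iUnion, Set.mem_union, Set.mem_ofPred_eq, not_exists, not_or,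
      not_lt, not_le] at hcon
    have hneg : ∀ u v : Fin d → ℝ, dotp (-u) v = - dotp u v := fun u v => by
      simp only [dotp_eq, neg_dotProduct]
    have hneg2 : ∀ u : Fin d → ℝ, dotp (-u) (-u) = dotp u u := fun u => by
      simp only [dotp_eq, neg_dotProduct_neg]
    have hX : ∀ j, ∑ i, dotp (q j) (q i) = dotp (q j) (q j) +
        ∑ i : Fin m, dotp (q j) (q (j.succAbove i)) := fun j =>
      Fin.sum_univ_succAbove _ j
    refine determ (Nat.succ_pos m) μc μs bs q L hL.le hd0 hdis hM hd ?_ ?_ ?_ ?_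
    · intro j
      obtain ⟨h1, h2, -⟩ := hcon j
      rw [hneg, hneg2] at h2
      exact abs_le.2 ⟨by linarith, h1⟩
    · intro j
      obtain ⟨-, -, h1, h2, -⟩ := hcon j
      rw [hneg, hneg2] at h2
      exact abs_le.2 ⟨by linarith, h1⟩
    · intro j
      obtain ⟨-, -, -, -, h1, -, -, h2⟩ := hcon j
      rw [hX]
      have : -(∑ i : Fin m, dotp (q j) (q (j.succAbove i))) < d / 8 :=
        lt_of_mul_lt_mul_left (by linarith) hl0.le
      linarith
    · intro j
      obtain ⟨-, -, -, -, -, h1, h2, -⟩ := hcon j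
      rw [hX]
      have : (∑ i : Fin m, dotp (q j) (q (j.succAbove i))) < d / 8 :=
        lt_of_mul_lt_mul_left h2 hl0.le
      linarith
  have hAc : noiseMeasure (m + 1) d Aᶜ ≤ ENNReal.ofReal δ := by
    calc noiseMeasure (m + 1) d Aᶜ ≤ noiseMeasure (m + 1) d (⋃ j, B j) := measure_mono hsub
      _ ≤ ∑ j, noiseMeasure (m + 1) d (B j) := measure_iUnion_fintype_le _ _
      _ ≤ ∑ _j : Fin (m + 1), 8 * p := Finset.sum_le_sum fun j _ => hB j
      _ = ENNReal.ofReal (N * (8 * Real.exp (-(2 * L)))) := by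
          rw [Finset.sum_const, Finset.card_univ, Fintype.card_fin, nsmul_eq_mul,
            ENNReal.ofReal_mul hN0.le, ENNReal.ofReal_mul (by norm_num), hN,
            ENNReal.ofReal_natCast]
          simp [hp]
      _ ≤ ENNReal.ofReal δ := by
          apply ENNReal.ofReal_le_ofReal
          have e : Real.exp (-(2 * L)) = (δ / N) ^ 2 := by
            rw [← neg_mul, mul_comm, mul_neg, ← neg_mul, mul_comm]
            have : Real.exp (2 * -L) = Real.exp (-L) ^ 2 := by
              rw [← Real.exp_nat_mul]; norm_num
            rw [this, Real.exp_neg, hLdef, Real.exp_log (by positivity), inv_div]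
          rw [e]
          have e2 : N * (8 * (δ / N) ^ 2) = 8 * δ ^ 2 / N := by field_simp
          rw [e2, div_le_iff₀ hN0]
          nlinarith
  have h1 : (1 : ENNReal) ≤ noiseMeasure (m + 1) d A + noiseMeasure (m + 1) d Aᶜ := by
    rw [← measure_univ (μ := noiseMeasure (m + 1) d), ← Set.union_compl_self A]
    exact measure_union_le _ _
  rw [ENNReal.ofReal_sub _ hδ0.le, ENNReal.ofReal_one]
  exact tsub_le_iff_right.2 (h1.trans (by gcongr))

end
end

section
/- (Lemma: correlation bounds along GD.) Under the problem-regime assumption with constant C and conditioned on the good event with constant c₁, for all iterations t > t₁ ≥ 0 and both b ∈ {±1}, the correlations ρ_{t,b} = ⟨w^t, ν_b⟩ of the GD iterates with the group means satisfy: (lower bound) ρ_{t+1,b} ≥ ρ_{t₁,b} + η R_+ · ( (1/2) L′_{t₁:t,b} + ( R_−/R_+ − c₁/C ) L′_{t₁:t,−b} ); and (upper bound) ρ_{t+1,b} ≤ ρ_{t₁,b} + η R_+ · ( (3/2) L′_{t₁:t,b} + ( R_−/R_+ + c₁ √( log(n/δ)/R_+ ) ) L′_{t₁:t,−b} ). 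-/
open MeasureTheory ProbabilityTheory Real Filter Finset
open scoped Classical

noncomputable section

lemma dotp_gd_succ {n d : ℕ} (η : ℝ) (z : Fin n → Fin d → ℝ) (bs : Fin n → ℝ)
    (Δ ω ι : ℝ → ℝ) (w0 v : Fin d → ℝ) (t : ℕ) :
    dotp (gd η z bs Δ ω ι w0 (t + 1)) v = dotp (gd η z bs Δ ω ι w0 t) v +
      η * ∑ i, ellp z bs Δ ω ι (gd η z bs Δ ω ι w0 t) i * dotp (z i) v := by
  simp only [dotp, gd, add_mul, Finset.sum_add_distrib, Finset.mul_sum, Finset.sum_mul]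
  congr 1
  rw [Finset.sum_comm]
  refine Finset.sum_congr rfl fun i _ => Finset.sum_congr rfl fun k _ => by
    ring

lemma sum_split_group {n : ℕ} (bs : Fin n → ℝ) (hbs : ∀ i, bs i = 1 ∨ bs i = -1)
    (b : ℝ) (hb : b = 1 ∨ b = -1) (f : Fin n → ℝ) :
    ∑ i, f i = ∑ i ∈ Finset.univ.filter (fun i => bs i = b), f i +
      ∑ i ∈ Finset.univ.filter (fun i => bs i = -b), f i := by
  rw [← Finset.sum_filter_add_sum_filter_not Finset.univ (fun i => bs i = b) f]
  congr 1
  refine Finset.sum_congr (Finset.filter_congr fun i _ => ?_) fun _ _ => rfl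
  rcases hbs i with h | h <;> rcases hb with h' | h' <;> rw [h, h'] <;> norm_num

/-- **Lemma (correlation bounds along GD).** Under the problem-regime assumption with
constant `C` (in particular `√R₊ ≥ C √(log(n/δ))`) and conditioned on the good event
with constant `c₁`, for all `t ≥ t₁ ≥ 0` and both groups `b ∈ {±1}`, the correlations
`ρ_{t,b} = ⟨w^t, ν_b⟩` satisfy the stated lower and upper bounds. -/
theorem gd_correlation_bounds (n d : ℕ) (μc μs : Fin d → ℝ) (δ : ℝ)
    (hδ0 : 0 < δ) (hδ1 : δ < 1)
    (bs : Fin n → ℝ) (hbs : ∀ i, bs i = 1 ∨ bs i = -1)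
    (z : Fin n → Fin d → ℝ) (c₁ : ℝ) (hc₁ : 1 ≤ c₁)
    (hgood : GoodEvent c₁ μc μs bs δ z)
    (C : ℝ) (hC : 0 < C) (hreg : Regime C n μc μs δ)
    (hRp : 0 < Rp μc μs)
    (hsqrt : Real.sqrt (Rp μc μs) ≥ C * Real.sqrt (Real.log ((n : ℝ) / δ)))
    (Δ ω ι : ℝ → ℝ) (hΔ1 : 0 < Δ 1) (hΔm : 0 < Δ (-1)) (hω1 : 0 < ω 1) (hωm : 0 < ω (-1))
    (η : ℝ) (hη : 0 < η) (w0 : Fin d → ℝ) :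
    ∀ b : ℝ, (b = 1 ∨ b = -1) → ∀ t₁ t : ℕ, t₁ ≤ t →
      (dotp (gd η z bs Δ ω ι w0 (t + 1)) (nuVec μc μs b) ≥
          dotp (gd η z bs Δ ω ι w0 t₁) (nuVec μc μs b) +
            η * Rp μc μs *
              (1 / 2 * LcumG η z bs Δ ω ι w0 b t₁ t +
                (Rm μc μs / Rp μc μs - c₁ / C) * LcumG η z bs Δ ω ι w0 (-b) t₁ t)) ∧
      (dotp (gd η z bs Δ ω ι w0 (t + 1)) (nuVec μc μs b) ≤
          dotp (gd η z bs Δ ω ι w0 t₁) (nuVec μc μs b) +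
            η * Rp μc μs *
              (3 / 2 * LcumG η z bs Δ ω ι w0 b t₁ t +
                (Rm μc μs / Rp μc μs +
                    c₁ * Real.sqrt (Real.log ((n : ℝ) / δ) / Rp μc μs)) *
                  LcumG η z bs Δ ω ι w0 (-b) t₁ t)) := by
  intro b hb t₁ t ht
  obtain ⟨-, -, hP, hM, -⟩ := hgood
  set R := Rp μc μs with hR
  set M := Rm μc μs with hMdef
  set lg := Real.log ((n : ℝ) / δ) with hlg
  have hℓ : ∀ w i, 0 ≤ ellp z bs Δ ω ι w i := by
    intro w i
    unfold ellp
    rcases hbs i with h | h <;> rw [h] <;> positivity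
  have hsR : 0 < Real.sqrt R := Real.sqrt_pos.mpr hRp
  have hRR : Real.sqrt R * Real.sqrt R = R := Real.mul_self_sqrt hRp.le
  have hup : R * (M / R + c₁ * Real.sqrt (lg / R)) = M + c₁ * Real.sqrt R * Real.sqrt lg := by
    rw [Real.sqrt_div' _ hRp.le]
    have : R * (M / R) = M := by field_simp
    have h2 : R * (c₁ * (Real.sqrt lg / Real.sqrt R)) = c₁ * Real.sqrt R * Real.sqrt lg := by
      rw [← hRR, Real.sqrt_mul_self hsR.le]
      field_simp
    rw [mul_add, this, h2]
  have hlow : R * (M / R - c₁ / C) ≤ M - c₁ * Real.sqrt R * Real.sqrt lg := by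
    have h1 : R * (M / R) = M := by field_simp
    have h2 : Real.sqrt R * Real.sqrt lg ≤ R / C := by
      rw [le_div_iff₀ hC]
      nlinarith
    have h3 : c₁ * (Real.sqrt R * Real.sqrt lg) ≤ c₁ * (R / C) :=
      mul_le_mul_of_nonneg_left h2 (by linarith)
    have h4 : R * (c₁ / C) = c₁ * (R / C) := by ring
    rw [mul_sub, h1, h4]
    linarith
  -- one step of gradient descent
  have step : ∀ τ : ℕ,
      R * (1 / 2 * (∑ i ∈ Finset.univ.filter (fun i => bs i = b),
            ellp z bs Δ ω ι (gd η z bs Δ ω ι w0 τ) i) +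
          (M / R - c₁ / C) * ∑ i ∈ Finset.univ.filter (fun i => bs i = -b),
            ellp z bs Δ ω ι (gd η z bs Δ ω ι w0 τ) i) ≤
        ∑ i, ellp z bs Δ ω ι (gd η z bs Δ ω ι w0 τ) i * dotp (z i) (nuVec μc μs b) ∧
      ∑ i, ellp z bs Δ ω ι (gd η z bs Δ ω ι w0 τ) i * dotp (z i) (nuVec μc μs b) ≤
      R * (3 / 2 * (∑ i ∈ Finset.univ.filter (fun i => bs i = b),
            ellp z bs Δ ω ι (gd η z bs Δ ω ι w0 τ) i) +
          (M / R + c₁ * Real.sqrt (lg / R)) * ∑ i ∈ Finset.univ.filter (fun i => bs i = -b),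
            ellp z bs Δ ω ι (gd η z bs Δ ω ι w0 τ) i) := by
    intro τ
    rw [sum_split_group bs hbs b hb]
    simp only [mul_add R, ← mul_assoc R, Finset.mul_sum]
    constructor
    · refine add_le_add (Finset.sum_le_sum fun i hi => ?_) (Finset.sum_le_sum fun i hi => ?_)
      · have hi' : bs i = b := (Finset.mem_filter.mp hi).2
        have h := abs_le.mp (hP i)
        rw [hi'] at h
        rw [mul_comm]
        exact mul_le_mul_of_nonneg_left (by linarith [h.1]) (hℓ _ i)
      · have hi' : bs i = -b := (Finset.mem_filter.mp hi).2
        have h := abs_le.mp (hM i)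
        rw [hi', neg_neg] at h
        rw [mul_comm]
        exact mul_le_mul_of_nonneg_left (by linarith [h.1]) (hℓ _ i)
    · refine add_le_add (Finset.sum_le_sum fun i hi => ?_) (Finset.sum_le_sum fun i hi => ?_)
      · have hi' : bs i = b := (Finset.mem_filter.mp hi).2
        have h := abs_le.mp (hP i)
        rw [hi'] at h
        rw [mul_comm]
        exact mul_le_mul_of_nonneg_right (by linarith [h.2]) (hℓ _ i)
      · have hi' : bs i = -b := (Finset.mem_filter.mp hi).2
        have h := abs_le.mp (hM i)
        rw [hi', neg_neg] at h
        rw [mul_comm]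
        refine mul_le_mul_of_nonneg_right ?_ (hℓ _ i)
        have := hup
        rw [mul_add] at this
        linarith [h.2]
  induction t, ht using Nat.le_induction with
  | base =>
    rw [dotp_gd_succ]
    simp only [LcumG, Finset.Icc_self, Finset.sum_singleton]
    obtain ⟨h1, h2⟩ := step t₁
    have h1' := mul_le_mul_of_nonneg_left h1 hη.le
    have h2' := mul_le_mul_of_nonneg_left h2 hη.le
    rw [← mul_assoc] at h1' h2'
    constructor <;> linarith
  | succ t ht ih =>
    rw [dotp_gd_succ]
    simp only [LcumG] at ih ⊢
    rw [Finset.sum_Icc_succ_top (by omega), Finset.sum_Icc_succ_top (by omega)]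
    obtain ⟨h1, h2⟩ := step (t + 1)
    have h1' := mul_le_mul_of_nonneg_left h1 hη.le
    have h2' := mul_le_mul_of_nonneg_left h2 hη.le
    obtain ⟨i1, i2⟩ := ih
    constructor <;> nlinarith

end
end

section
/- (Lemma: comparison of group gradient sums.) Suppose R_−/R_+ ≥ 0, the hyperparameters satisfy (1/2)(n_±/n) ≤ Δ_± ≤ 2(n_±/n), the constant C can be taken sufficiently large relative to c₁, and the gradient-ratio bound ℓ′_{i,t}/ℓ′_{j,t} ≤ 4c₁² Δ_{b_j}/Δ_{b_i} holds for all t and all i, j ∈ [n]. Then there exists a constant c₀ with 0 < c₀ < 1/2 such that for every iteration t and both b ∈ {±1}: c₀ · L′_t ≤ (1/2) L′_{t,b} + ( R_−/R_+ − c₁/C ) L′_{t,−b}, where L′_{t,b} = Σ_{i : b_i = b} ℓ′_{i,t} and L′_t = L′_{t,+1} + L′_{t,−1}. -/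
open MeasureTheory ProbabilityTheory Real Filter Finset
open scoped Classical

noncomputable section

/-- One-sided comparison of group sums: `L′_{b'} ≤ 16 c₁² L′_b`. -/
theorem group_sum_aux {n : ℕ} (c₁ : ℝ) (bs : Fin n → ℝ) (Δ : ℝ → ℝ) (l : Fin n → ℝ)
    (hl : ∀ i, 0 < l i) (b b' : ℝ) (hb : 0 < Δ b) (hb' : 0 < Δ b')
    (h1 : Δ b ≤ 2 * ((ngroup bs b : ℝ) / n)) (h2 : 1 / 2 * ((ngroup bs b' : ℝ) / n) ≤ Δ b')
    (hr : ∀ i j, l i / l j ≤ 4 * c₁ ^ 2 * (Δ (bs j) / Δ (bs i))) :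
    ∑ i ∈ Finset.univ.filter (fun i => bs i = b'), l i ≤
      16 * c₁ ^ 2 * ∑ i ∈ Finset.univ.filter (fun i => bs i = b), l i := by
  have hn : (0 : ℝ) < n := by
    rcases Nat.eq_zero_or_pos n with h | h
    · subst h
      simp at h1
      linarith
    · exact_mod_cast h
  have hnb : (0 : ℝ) < ngroup bs b := by
    by_contra hc
    have h0 : (ngroup bs b : ℝ) = 0 := le_antisymm (not_lt.mp hc) (Nat.cast_nonneg _)
    rw [h0] at h1
    simp at h1
    linarith
  have h1' : Δ b * n ≤ 2 * ngroup bs b := by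
    rw [← mul_div_assoc, le_div_iff₀ hn] at h1
    exact h1
  have h2' : (ngroup bs b' : ℝ) ≤ 2 * (n * Δ b') := by
    rw [← mul_div_assoc, div_le_iff₀ hn] at h2
    linarith
  have key : ∑ i ∈ Finset.univ.filter (fun i => bs i = b'),
      ∑ j ∈ Finset.univ.filter (fun i => bs i = b), l i * Δ b' ≤
      ∑ i ∈ Finset.univ.filter (fun i => bs i = b'),
      ∑ j ∈ Finset.univ.filter (fun i => bs i = b), 4 * c₁ ^ 2 * Δ b * l j := by
    refine Finset.sum_le_sum fun i hi => Finset.sum_le_sum fun j hj => ?_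
    have hi' := (Finset.mem_filter.mp hi).2
    have hj' := (Finset.mem_filter.mp hj).2
    have h := hr i j
    rw [hi', hj', ← mul_div_assoc, div_le_div_iff₀ (hl j) hb'] at h
    exact h
  simp only [Finset.sum_const, nsmul_eq_mul, ← Finset.mul_sum, ← Finset.sum_mul] at key
  have hkey : (ngroup bs b : ℝ) *
      ((∑ i ∈ Finset.univ.filter (fun i => bs i = b'), l i) * Δ b') ≤
      (ngroup bs b' : ℝ) *
      (4 * c₁ ^ 2 * Δ b * ∑ i ∈ Finset.univ.filter (fun i => bs i = b), l i) := by
    simpa only [ngroup, ← Finset.mul_sum] using key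
  have hS : 0 ≤ ∑ i ∈ Finset.univ.filter (fun i => bs i = b), l i :=
    Finset.sum_nonneg fun i _ => (hl i).le
  generalize (∑ i ∈ Finset.univ.filter (fun i => bs i = b), l i) = S at *
  generalize (∑ i ∈ Finset.univ.filter (fun i => bs i = b'), l i) = T at *
  have h3 : (ngroup bs b' : ℝ) * Δ b ≤ 4 * ngroup bs b * Δ b' := by
    calc (ngroup bs b' : ℝ) * Δ b ≤ 2 * (n * Δ b') * Δ b := by gcongr
      _ = 2 * Δ b' * (Δ b * n) := by ring
      _ ≤ 2 * Δ b' * (2 * ngroup bs b) := by gcongr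
      _ = _ := by ring
  have h4 : 4 * c₁ ^ 2 * S * (ngroup bs b' * Δ b) ≤
      4 * c₁ ^ 2 * S * (4 * ngroup bs b * Δ b') := by gcongr
  have hp : 0 < (ngroup bs b : ℝ) * Δ b' := mul_pos hnb hb'
  refine le_of_mul_le_mul_left ?_ hp
  linarith

/-- Final arithmetic step. -/
theorem group_arith_aux (c₁ C S T r : ℝ) (hc₁ : 1 ≤ c₁) (hC : C ≥ 64 * c₁ ^ 3)
    (hr : 0 ≤ r) (hT : 0 ≤ T) (h : T ≤ 16 * c₁ ^ 2 * S) :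
    1 / (4 * (1 + 16 * c₁ ^ 2)) * (S + T) ≤ 1 / 2 * S + (r - c₁ / C) * T := by
  have hc : 0 < c₁ := by linarith
  have hCp : 0 < C := lt_of_lt_of_le (by positivity) hC
  have a1 : 1 / (4 * (1 + 16 * c₁ ^ 2)) * (S + T) ≤ S / 4 := by
    rw [one_div_mul_eq_div, div_le_iff₀ (by positivity)]
    linarith
  have a2 : c₁ / C * T ≤ S / 4 := by
    rw [div_mul_eq_mul_div, div_le_iff₀ hCp]
    have hS : 0 ≤ S := by
      by_contra hs
      have : 16 * c₁ ^ 2 * S < 0 := mul_neg_of_pos_of_neg (by positivity) (not_le.mp hs)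
      linarith
    have e1 : c₁ * T ≤ c₁ * (16 * c₁ ^ 2 * S) := by gcongr
    have e2 : S / 4 * (64 * c₁ ^ 3) ≤ S / 4 * C := by gcongr
    linarith
  have a3 : 0 ≤ r * T := mul_nonneg hr hT
  linarith

/-- **Lemma (comparison of group gradient sums).** If `R₋/R₊ ≥ 0`, the hyperparameters
satisfy `(1/2)(n_±/n) ≤ Δ_± ≤ 2(n_±/n)`, `C` is large enough relative to `c₁`, and the
gradient-ratio bound `ℓ′_{i,t}/ℓ′_{j,t} ≤ 4c₁² Δ_{b_j}/Δ_{b_i}` holds for all `t, i, j`,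
then there is `0 < c₀ < 1/2` with
`c₀ L′_t ≤ (1/2) L′_{t,b} + (R₋/R₊ − c₁/C) L′_{t,−b}` for every `t` and `b ∈ {±1}`. -/
theorem group_gradient_sum_comparison (c₁ : ℝ) (hc₁ : 1 ≤ c₁) :
    ∃ C₀ : ℝ, 0 < C₀ ∧
      ∀ C : ℝ, C ≥ C₀ →
        ∀ (n d : ℕ) (μc μs : Fin d → ℝ) (bs : Fin n → ℝ), (∀ i, bs i = 1 ∨ bs i = -1) →
        ∀ z : Fin n → Fin d → ℝ, ∀ Δ ω ι : ℝ → ℝ,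
          (0 < Δ 1) → (0 < Δ (-1)) → (0 < ω 1) → (0 < ω (-1)) →
          0 < Rp μc μs → 0 ≤ Rm μc μs / Rp μc μs →
          (1 / 2 * ((ngroup bs 1 : ℝ) / n) ≤ Δ 1 ∧ Δ 1 ≤ 2 * ((ngroup bs 1 : ℝ) / n)) →
          (1 / 2 * ((ngroup bs (-1) : ℝ) / n) ≤ Δ (-1) ∧
              Δ (-1) ≤ 2 * ((ngroup bs (-1) : ℝ) / n)) →
          ∀ (η : ℝ) (w0 : Fin d → ℝ),
          (∀ (t : ℕ) (i j : Fin n),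
              ellp z bs Δ ω ι (gd η z bs Δ ω ι w0 t) i /
                  ellp z bs Δ ω ι (gd η z bs Δ ω ι w0 t) j ≤
                4 * c₁ ^ 2 * (Δ (bs j) / Δ (bs i))) →
          ∃ c₀ : ℝ, 0 < c₀ ∧ c₀ < 1 / 2 ∧
            ∀ t : ℕ, ∀ b : ℝ, (b = 1 ∨ b = -1) →
              c₀ * (LcumG η z bs Δ ω ι w0 1 t t + LcumG η z bs Δ ω ι w0 (-1) t t) ≤
                1 / 2 * LcumG η z bs Δ ω ι w0 b t t +
                  (Rm μc μs / Rp μc μs - c₁ / C) * LcumG η z bs Δ ω ι w0 (-b) t t := by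
  refine ⟨64 * c₁ ^ 3, by positivity, ?_⟩
  intro C hC n d μc μs bs hbs z Δ ω ι hΔ1 hΔ2 hω1 hω2 hRp hR h1 h2 η w0 hr
  have hden : (0 : ℝ) < 4 * (1 + 16 * c₁ ^ 2) := by positivity
  refine ⟨1 / (4 * (1 + 16 * c₁ ^ 2)), by positivity, ?_, ?_⟩
  · rw [div_lt_div_iff₀ hden (by norm_num)]
    nlinarith [sq_nonneg c₁]
  intro t b hb
  have hl : ∀ i, 0 < ellp z bs Δ ω ι (gd η z bs Δ ω ι w0 t) i := by
    intro i
    unfold ellp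
    rcases hbs i with h | h <;> rw [h] <;> positivity
  have hnn : ∀ b, 0 ≤ LcumG η z bs Δ ω ι w0 b t t := by
    intro b
    simp only [LcumG, Finset.Icc_self, Finset.sum_singleton]
    exact Finset.sum_nonneg fun i _ => (hl i).le
  have A : LcumG η z bs Δ ω ι w0 (-1) t t ≤ 16 * c₁ ^ 2 * LcumG η z bs Δ ω ι w0 1 t t := by
    simp only [LcumG, Finset.Icc_self, Finset.sum_singleton]
    exact group_sum_aux c₁ bs Δ _ hl 1 (-1) hΔ1 hΔ2 h1.2 h2.1 (hr t)
  have B : LcumG η z bs Δ ω ι w0 1 t t ≤ 16 * c₁ ^ 2 * LcumG η z bs Δ ω ι w0 (-1) t t := by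
    simp only [LcumG, Finset.Icc_self, Finset.sum_singleton]
    exact group_sum_aux c₁ bs Δ _ hl (-1) 1 hΔ2 hΔ1 h2.2 h1.1 (hr t)
  rcases hb with rfl | rfl
  · exact group_arith_aux c₁ C _ _ _ hc₁ hC hR (hnn _) A
  · rw [neg_neg, add_comm (LcumG η z bs Δ ω ι w0 1 t t)]
    exact group_arith_aux c₁ C _ _ _ hc₁ hC hR (hnn _) B

end
end

section
/- (Support vector proliferation / interpolation.) In the setting of Theorem 1, let w_CS-SVM be the solution of the cost-sensitive SVM: minimize ‖w‖₂ subject to Δ_{b_i} ⟨z_i, w⟩ ≥ 1 for all i ∈ [n], and suppose the GD iterates on the exponential VS-loss converge in direction to it, w^t/‖w^t‖₂ → w_CS-SVM/‖w_CS-SVM‖₂, while all scaled margins equalize (for all i, j: Δ_{b_i} ⟨z_i, w̄^∞⟩ = Δ_{b_j} ⟨z_j, w̄^∞⟩). Then every training point is a support vector: for all i ∈ [n], Δ_{b_i} ⟨z_i, w_CS-SVM⟩ = 1, i.e. ⟨z_i, w_CS-SVM⟩ = 1/Δ_{b_i}; equivalently, the suitably rescaled GD iterates (‖w_CS-SVM‖₂/‖w^t‖₂)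 · ⟨z_i, w^t⟩ converge to 1/Δ_{b_i} for every i, so the GD solution interpolates the pairs {(x_i, y_i/Δ_{b_i}) : i ∈ [n]}. -/
open MeasureTheory ProbabilityTheory Real Filter Finset
open scoped Classical

noncomputable section

theorem aux_dotp_smul_right {d : ℕ} (c : ℝ) (u v : Fin d → ℝ) :
    dotp u (c • v) = c * dotp u v := by
  unfold dotp
  rw [Finset.mul_sum]
  refine Finset.sum_congr rfl fun k _ => ?_
  simp only [Pi.smul_apply, smul_eq_mul]
  ring

theorem aux_nrm_smul {d : ℕ} (c : ℝ) (hc : 0 ≤ c) (v : Fin d → ℝ) :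
    nrm (c • v) = c * nrm v := by
  have h : dotp (c • v) (c • v) = c ^ 2 * dotp v v := by
    unfold dotp
    rw [Finset.mul_sum]
    refine Finset.sum_congr rfl fun k _ => ?_
    simp only [Pi.smul_apply, smul_eq_mul]
    ring
  unfold nrm
  rw [h, Real.sqrt_mul (sq_nonneg c), Real.sqrt_sq hc]

theorem aux_nrm_pos {d : ℕ} (u v : Fin d → ℝ) (h : dotp u v ≠ 0) : 0 < nrm v := by
  unfold nrm
  refine Real.sqrt_pos.mpr ?_
  have h0 : 0 ≤ dotp v v := Finset.sum_nonneg fun k _ => mul_self_nonneg (v k)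
  refine lt_of_le_of_ne h0 fun he => h ?_
  have hz := (Finset.sum_eq_zero_iff_of_nonneg
    (fun k _ => mul_self_nonneg (v k))).mp he.symm
  unfold dotp
  refine Finset.sum_eq_zero fun k hk => ?_
  rw [mul_self_eq_zero.mp (hz k hk), mul_zero]

/-- **Support vector proliferation / interpolation.** If `w_CS-SVM` solves the
cost-sensitive SVM (`min ‖w‖₂` s.t. `Δ_{b_i}⟨z_i,w⟩ ≥ 1`), the GD iterates converge in
direction to it, and all scaled margins equalize at the limit direction, then every
training point is a support vector: `Δ_{b_i}⟨z_i, w_CS-SVM⟩ = 1` for all `i`, and the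
rescaled GD margins `(‖w_CS-SVM‖/‖w^t‖)⟨z_i, w^t⟩` converge to `1/Δ_{b_i}`. -/
theorem support_vector_proliferation (n d : ℕ) (z : Fin n → Fin d → ℝ) (bs : Fin n → ℝ)
    (hbs : ∀ i, bs i = 1 ∨ bs i = -1)
    (Δ ω ι : ℝ → ℝ) (hΔ1 : 0 < Δ 1) (hΔm : 0 < Δ (-1)) (hω1 : 0 < ω 1) (hωm : 0 < ω (-1))
    (η : ℝ) (hη : 0 < η)
    (wsvm : Fin d → ℝ)
    (hfeas : ∀ i, 1 ≤ Δ (bs i) * dotp (z i) wsvm)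
    (hopt : ∀ w : Fin d → ℝ, (∀ i, 1 ≤ Δ (bs i) * dotp (z i) w) → nrm wsvm ≤ nrm w)
    (hdir : Tendsto (fun t => (nrm (gd η z bs Δ ω ι 0 t))⁻¹ • gd η z bs Δ ω ι 0 t)
      atTop (nhds ((nrm wsvm)⁻¹ • wsvm)))
    (hmargins : ∀ i j : Fin n,
      Δ (bs i) * dotp (z i) ((nrm wsvm)⁻¹ • wsvm) =
        Δ (bs j) * dotp (z j) ((nrm wsvm)⁻¹ • wsvm)) :
    (∀ i, Δ (bs i) * dotp (z i) wsvm = 1) ∧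
      ∀ i, Tendsto
        (fun t => nrm wsvm / nrm (gd η z bs Δ ω ι 0 t) * dotp (z i) (gd η z bs Δ ω ι 0 t))
        atTop (nhds (1 / Δ (bs i))) := by
  have hpos : ∀ i, 0 < nrm wsvm := fun i => by
    refine aux_nrm_pos (z i) wsvm fun h => ?_
    have := hfeas i
    rw [h, mul_zero] at this
    linarith
  have hΔ : ∀ i, Δ (bs i) ≠ 0 := fun i h => by
    have := hfeas i
    rw [h, zero_mul] at this
    linarith
  have hone : ∀ i, Δ (bs i) * dotp (z i) wsvm = 1 := fun i => by
    have hN := hpos i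
    have heq : ∀ j, Δ (bs j) * dotp (z j) wsvm = Δ (bs i) * dotp (z i) wsvm := fun j => by
      have h := hmargins j i
      rw [aux_dotp_smul_right, aux_dotp_smul_right, mul_left_comm,
        mul_left_comm (Δ (bs i))] at h
      exact mul_left_cancel₀ (inv_ne_zero hN.ne') h
    have h1 := hfeas i
    set m := Δ (bs i) * dotp (z i) wsvm with hm
    have hm0 : 0 < m := by linarith
    have h2 := hopt (m⁻¹ • wsvm) fun j => by
      rw [aux_dotp_smul_right, mul_left_comm, heq j, inv_mul_cancel₀ hm0.ne']
    rw [aux_nrm_smul _ (inv_nonneg.mpr hm0.le)] at h2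
    have h3 : m * nrm wsvm ≤ nrm wsvm := by
      have h4 := mul_le_mul_of_nonneg_left h2 hm0.le
      rwa [mul_inv_cancel_left₀ hm0.ne'] at h4
    have h5 : m ≤ 1 := by
      by_contra hlt
      push Not at hlt
      nlinarith
    linarith
  refine ⟨hone, fun i => ?_⟩
  have hN := hpos i
  have hcont : Continuous fun v : Fin d → ℝ => nrm wsvm * dotp (z i) v := by
    unfold dotp
    fun_prop
  have ht := (hcont.tendsto _).comp hdir
  have hlim : nrm wsvm * dotp (z i) ((nrm wsvm)⁻¹ • wsvm) = 1 / Δ (bs i) := by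
    rw [aux_dotp_smul_right, mul_inv_cancel_left₀ hN.ne', eq_div_iff (hΔ i), mul_comm]
    exact hone i
  rw [hlim] at ht
  refine ht.congr fun t => ?_
  simp only [Function.comp_apply]
  rw [aux_dotp_smul_right, div_eq_mul_inv, mul_assoc]

end
end

section
/- (Properties of GD on separable data.) Let ℓ : ℝ → ℝ be a convex, differentiable, strictly decreasing loss, and consider the empirical risk L_n(w) = (1/n) Σ_{i∈[n]} ℓ(⟨z_i, w⟩) over data z_1, …, z_n ∈ ℝ^d. Run gradient descent w^{t+1} = w^t − η ∇L_n(w^t) with a step size η > 0 small enough that the descent condition L_n(w^{t+1}) − L_n(w^t) ≤ −(η/2) ‖∇L_n(w^t)‖₂² holds for all t. If the data are linearly separable (there exists u with ⟨z_i, u⟩ > 0 for all i), then (i) the sequence of loss values {L_n(w^t)}_{t≥0} is non-increasing, and (ii) the iterate norms diverge: lim_{t→∞} ‖w^t‖₂ = ∞. -/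
open MeasureTheory ProbabilityTheory Real Filter Finset
open scoped Classical

noncomputable section

/-- Empirical risk `L_n(w) = (1/n) Σ_i ℓ(⟨z_i, w⟩)`. -/
def empLoss {n d : ℕ} (ℓ : ℝ → ℝ) (z : Fin n → Fin d → ℝ) (w : Fin d → ℝ) : ℝ :=
  (1 / n) * ∑ i, ℓ (dotp (z i) w)

/-- Gradient of the empirical risk: `∇L_n(w) = (1/n) Σ_i ℓ'(⟨z_i, w⟩) z_i`. -/
def empGrad {n d : ℕ} (ℓ : ℝ → ℝ) (z : Fin n → Fin d → ℝ) (w : Fin d → ℝ) :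
    Fin d → ℝ :=
  fun k => (1 / n) * ∑ i, deriv ℓ (dotp (z i) w) * z i k

/-- Cauchy-Schwarz for `dotp` and `nrm`. -/
theorem dotp_le_nrm {d : ℕ} (u v : Fin d → ℝ) : dotp u v ≤ nrm u * nrm v := by
  unfold nrm dotp
  have h := Real.sum_mul_le_sqrt_mul_sqrt Finset.univ u v
  simpa [pow_two] using h

/-- If the inner product with a fixed vector diverges then so does the norm. -/
theorem nrm_tendsto_of_dotp {d : ℕ} (v : Fin d → ℝ) (w : ℕ → Fin d → ℝ)
    (h : Tendsto (fun t => dotp v (w t)) atTop atTop) :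
    Tendsto (fun t => nrm (w t)) atTop atTop := by
  have hv : 0 ≤ nrm v := Real.sqrt_nonneg _
  have h1 : Tendsto (fun t => dotp v (w t) / (nrm v + 1)) atTop atTop :=
    h.atTop_div_const (by linarith)
  refine tendsto_atTop_mono (fun t => ?_) h1
  have hw : 0 ≤ nrm (w t) := Real.sqrt_nonneg _
  rw [div_le_iff₀ (by linarith)]
  have := dotp_le_nrm v (w t)
  nlinarith

/-- **Properties of GD on separable data.** For a convex, differentiable, strictly
decreasing loss and gradient descent satisfying the step-size descent condition, if the
data are linearly separable then the loss values are non-increasing and the iterate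
norms diverge. -/
theorem gd_properties_separable (n d : ℕ) (hn : 0 < n) (z : Fin n → Fin d → ℝ)
    (ℓ : ℝ → ℝ) (hconv : ConvexOn ℝ Set.univ ℓ) (hdiff : Differentiable ℝ ℓ)
    (hanti : StrictAnti ℓ) (η : ℝ) (hη : 0 < η)
    (w : ℕ → Fin d → ℝ)
    (hgd : ∀ t : ℕ, w (t + 1) = fun k => w t k - η * empGrad ℓ z (w t) k)
    (hdescent : ∀ t : ℕ,
      empLoss ℓ z (w (t + 1)) - empLoss ℓ z (w t) ≤
        -(η / 2) * dotp (empGrad ℓ z (w t)) (empGrad ℓ z (w t)))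
    (hsep : ∃ u : Fin d → ℝ, ∀ i, 0 < dotp (z i) u) :
    (∀ t : ℕ, empLoss ℓ z (w (t + 1)) ≤ empLoss ℓ z (w t)) ∧
      Tendsto (fun t => nrm (w t)) atTop atTop := by
  refine ⟨fun t => ?_, ?_⟩
  · have h0 : 0 ≤ dotp (empGrad ℓ z (w t)) (empGrad ℓ z (w t)) :=
      Finset.sum_nonneg fun k _ => mul_self_nonneg _
    have := hdescent t
    nlinarith
  obtain ⟨u, hu⟩ := hsep
  have hmono : Monotone (deriv ℓ) := by
    have h := hconv.monotoneOn_deriv (fun x _ => hdiff x)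
    exact fun x y hxy => h (Set.mem_univ x) (Set.mem_univ y) hxy
  have hneg : ∀ x, deriv ℓ x < 0 := by
    intro x
    have h := hconv.deriv_le_slope (Set.mem_univ x) (Set.mem_univ (x + 1))
      (by linarith) (hdiff x)
    have h2 := hanti (show x < x + 1 by linarith)
    rw [slope_def_field, show x + 1 - x = (1 : ℝ) by ring, div_one] at h
    linarith
  have hn' : (0 : ℝ) < n := by exact_mod_cast hn
  have hstep : ∀ t, dotp u (w (t + 1)) - dotp u (w t) =
      η / n * ∑ i, (-deriv ℓ (dotp (z i) (w t))) * dotp (z i) u := by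
    intro t
    rw [hgd t]
    unfold empGrad
    simp only [dotp, Finset.mul_sum]
    rw [Finset.sum_comm, ← Finset.sum_sub_distrib]
    refine Finset.sum_congr rfl fun k _ => ?_
    rw [mul_sub, sub_sub_cancel_left, Finset.mul_sum, ← Finset.sum_neg_distrib]
    refine Finset.sum_congr rfl fun i _ => ?_
    ring
  have hterm : ∀ t i, 0 ≤ (-deriv ℓ (dotp (z i) (w t))) * dotp (z i) u := fun t i =>
    mul_nonneg (by linarith [hneg (dotp (z i) (w t))]) (hu i).le
  have hηn : 0 < η / n := div_pos hη hn'
  have hmonoA : Monotone (fun t => dotp u (w t)) := by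
    refine monotone_nat_of_le_succ fun t => ?_
    have h1 := hstep t
    have h2 := mul_nonneg hηn.le (Finset.sum_nonneg fun i (_ : i ∈ Finset.univ) => hterm t i)
    linarith
  rcases tendsto_of_monotone hmonoA with h | ⟨l, hl⟩
  · exact nrm_tendsto_of_dotp u w h
  let i₀ : Fin n := ⟨0, hn⟩
  refine nrm_tendsto_of_dotp (z i₀) w ?_
  have hdiff0 : Tendsto (fun t => dotp u (w (t + 1)) - dotp u (w t)) atTop (nhds 0) := by
    have := (hl.comp (tendsto_add_atTop_nat 1)).sub hl
    simpa using this
  refine tendsto_atTop.2 fun B => ?_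
  have hB : 0 < η / n * (-deriv ℓ B * dotp (z i₀) u) :=
    mul_pos hηn (mul_pos (by linarith [hneg B]) (hu i₀))
  filter_upwards [hdiff0.eventually_lt_const hB] with t ht
  rw [hstep t] at ht
  have h1 := lt_of_mul_lt_mul_left ht hηn.le
  have h2 := Finset.single_le_sum (fun i _ => hterm t i) (Finset.mem_univ i₀)
  have h3 := lt_of_mul_lt_mul_right (lt_of_le_of_lt h2 h1) (hu i₀).le
  by_contra hc
  have := hmono (not_le.1 hc).le
  linarith

end
end
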